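/- Suppose H = ℝ^N, p > 1 and α > 0. Then there exists a minimizer μ_min ∈ M_p(Z) of the problem inf_{μ ∈ KRu(Z)} F(Aμ) + G_{α,β}(μ) that can be written as μ_min = Σ_{i=1}^N c_i(δ_{z_i} − δ_{w_i}) + μ_min(Z) δ_e, where c_i ∈ ℝ and z_i, w_i ∈ Z. -/

import Mathlib

open MeasureTheory Filter Topology
open scoped ENNReal NNReal

noncomputable section
attribute [local instance] Classical.propDecidable

variable {Z : Type*} [MetricSpace Z] [MeasurableSpace Z] [BorelSpace Z]

/-- Integral `∫ f dμ` of a function against a finite signed measure, via Jordan decomposition. -/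
def sInteg (μ : SignedMeasure Z) (f : Z → ℝ) : ℝ :=
  (∫ z, f z ∂μ.toJordanDecomposition.posPart) - ∫ z, f z ∂μ.toJordanDecomposition.negPart

/-- Total variation norm `‖μ‖_TV`. -/
def tvNorm (μ : SignedMeasure Z) : ℝ := (μ.totalVariation Set.univ).toReal

/-- The unbalanced Kantorovich–Rubinstein norm
`‖μ‖_KRu = |μ(Z)| + sup { ∫ f dμ : f(e) = 0, Lip(f) ≤ 1 }`. -/
def kruNorm (e : Z) (μ : SignedMeasure Z) : ℝ :=
  |μ Set.univ| +
    sSup {r : ℝ | ∃ f : Z → ℝ, f e = 0 ∧ LipschitzWith 1 f ∧ r = sInteg μ f}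

/-- The balanced Kantorovich–Rubinstein norm `‖μ‖_KR = sup { ∫ f dμ : f(e) = 0, Lip(f) ≤ 1 }`. -/
def krNorm (e : Z) (μ : SignedMeasure Z) : ℝ :=
  sSup {r : ℝ | ∃ f : Z → ℝ, f e = 0 ∧ LipschitzWith 1 f ∧ r = sInteg μ f}

/-- `μ ∈ M_1(Z)`: finite first moment, `∫ d(z,e) d|μ| < ∞`. -/
def MemM1 (e : Z) (μ : SignedMeasure Z) : Prop :=
  (∫⁻ z, ENNReal.ofReal (dist z e) ∂μ.totalVariation) < ⊤

/-- `μ ∈ M_p(Z)`: finite `p`-th moment, `∫ d(z,e)^p d|μ| < ∞`. -/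
def MemMp (e : Z) (p : ℝ) (μ : SignedMeasure Z) : Prop :=
  (∫⁻ z, ENNReal.ofReal (dist z e ^ p) ∂μ.totalVariation) < ⊤

/-- `∫ (1 + d(z,e)^p) d|μ|` as an extended nonnegative real number. -/
def momLint (e : Z) (p : ℝ) (μ : SignedMeasure Z) : ℝ≥0∞ :=
  ∫⁻ z, ENNReal.ofReal (1 + dist z e ^ p) ∂μ.totalVariation

/-- Dirac measure at a point, as a signed measure. -/
def diracSM (x : Z) : SignedMeasure Z := (Measure.dirac x).toSignedMeasure

/-- The regularizer `G_{α,β}(μ) = α‖μ‖_KRu + β ∫ (1 + d(z,e)^p) d|μ|` if `μ ∈ M_p(Z)`,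
and `+∞` otherwise, as an extended real number. -/
def Gab (e : Z) (p α β : ℝ) (μ : SignedMeasure Z) : EReal :=
  if MemMp e p μ then ((α * kruNorm e μ + β * (momLint e p μ).toReal : ℝ) : EReal) else ⊤

/-- A geodesic metric space: any two points are joined by points realizing all
intermediate distance proportions. -/
def IsGeodesic (Z : Type*) [MetricSpace Z] : Prop :=
  ∀ x y : Z, ∀ t : ℝ, 0 ≤ t → t ≤ 1 →
    ∃ z : Z, dist x z = t * dist x y ∧ dist z y = (1 - t) * dist x y

/-! ### Hopf–Rinow -/

theorem hr_thick {Z : Type*} [MetricSpace Z] (hgeo : IsGeodesic Z) (e : Z) (r δ : ℝ)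
    (hr : 0 ≤ r) (y : Z) (hy : dist y e ≤ r + δ) (hδ : 0 ≤ δ) :
    ∃ z, dist z e ≤ r ∧ dist y z ≤ δ := by
  by_cases h : dist y e ≤ r
  · exact ⟨y, h, by simpa using hδ⟩
  · push Not at h
    have hd : 0 < dist e y := by rw [dist_comm]; linarith
    rw [dist_comm] at h hy
    obtain ⟨z, h1, h2⟩ := hgeo e y (r / dist e y) (by positivity)
      (by rw [div_le_one hd]; exact h.le)
    refine ⟨z, ?_, ?_⟩
    · rw [dist_comm, h1]; field_simp; exact le_refl _
    · rw [dist_comm, h2]; field_simp; linarith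

theorem hr_proper {Z : Type*} [MetricSpace Z] [LocallyCompactSpace Z] [CompleteSpace Z]
    (hgeo : IsGeodesic Z) (e : Z) : ProperSpace Z := by
  have key : ∀ r : ℝ, 0 ≤ r → IsCompact (Metric.closedBall e r) := by
    by_contra hcon
    push Not at hcon
    obtain ⟨r0, hr0, hnc⟩ := hcon
    let I : Set ℝ := {r | 0 ≤ r ∧ IsCompact (Metric.closedBall e r)}
    have h0 : (0 : ℝ) ∈ I := ⟨le_refl _, by simp⟩
    have hb : BddAbove I := by
      refine ⟨r0, fun r hr => ?_⟩
      by_contra hlt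
      push Not at hlt
      exact hnc (hr.2.of_isClosed_subset Metric.isClosed_closedBall
        (Metric.closedBall_subset_closedBall hlt.le))
    have hR0 : 0 ≤ sSup I := le_csSup hb h0
    have hRI : IsCompact (Metric.closedBall e (sSup I)) := by
      rw [isCompact_iff_totallyBounded_isComplete]
      refine ⟨?_, Metric.isClosed_closedBall.isComplete⟩
      rw [Metric.totallyBounded_iff]
      intro ε hε
      obtain ⟨r, hrI, hr⟩ := exists_lt_of_lt_csSup ⟨0, h0⟩ (show sSup I - ε / 2 < sSup I by linarith)
      obtain ⟨t, ht, hcov⟩ := Metric.totallyBounded_iff.1 hrI.2.totallyBounded (ε / 2) (by linarith)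
      refine ⟨t, ht, fun y hy => ?_⟩
      obtain ⟨z, hz1, hz2⟩ := hr_thick hgeo e r (ε / 2) hrI.1 y
        (by have := Metric.mem_closedBall.1 hy; linarith) (by linarith)
      have := hcov (Metric.mem_closedBall.2 hz1)
      simp only [Set.mem_iUnion, Metric.mem_ball] at this ⊢
      obtain ⟨a, ha, hza⟩ := this
      exact ⟨a, ha, by have := dist_triangle y z a; linarith⟩
    obtain ⟨δ, hδ, hc⟩ := hRI.exists_isCompact_cthickening
    have : sSup I + δ ∈ I := by
      refine ⟨by linarith, hc.of_isClosed_subset Metric.isClosed_closedBall fun y hy => ?_⟩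
      obtain ⟨z, hz1, hz2⟩ := hr_thick hgeo e _ δ hR0 y (Metric.mem_closedBall.1 hy) hδ.le
      exact Metric.mem_cthickening_of_dist_le y z δ _ (Metric.mem_closedBall.2 hz1) hz2
    have := le_csSup hb this
    linarith
  exact ProperSpace.of_isCompact_closedBall_of_le 0 (fun x r hr => by
    refine (key (r + dist x e) (by positivity)).of_isClosed_subset Metric.isClosed_closedBall ?_
    exact Metric.closedBall_subset_closedBall' (le_refl _))

/-! ### Conic Carathéodory -/

/-- Combinations of `N` elements of `S` with nonnegative coefficients of sum at most `t`. -/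
def conicK {E : Type*} [AddCommGroup E] [Module ℝ E] (S : Set E) (N : ℕ) (t : ℝ) : Set E :=
  {x | ∃ c : Fin N → ℝ, ∃ s : Fin N → E, (∀ i, 0 ≤ c i) ∧ ∑ i, c i ≤ t ∧ (∀ i, s i ∈ S) ∧
    x = ∑ i, c i • s i}

theorem conicK_add {E : Type*} [AddCommGroup E] [Module ℝ E] {S : Set E} (h0 : (0 : E) ∈ S)
    {n : ℕ} {t : ℝ} (k : ℕ) {x : E} (hx : x ∈ conicK S n t) : x ∈ conicK S (n + k) t := by
  obtain ⟨c, s, hc, hct, hs, rfl⟩ := hx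
  refine ⟨Fin.append c (fun _ => 0), Fin.append s (fun _ => 0), ?_, ?_, ?_, ?_⟩
  · intro i
    induction i using Fin.addCases <;> simp [hc]
  · simpa [Fin.sum_univ_add] using hct
  · intro i
    induction i using Fin.addCases <;> simp [hs, h0]
  · simp [Fin.sum_univ_add]

theorem carath_step {E : Type*} [AddCommGroup E] [Module ℝ E] [FiniteDimensional ℝ E]
    (T : Finset E) (hT : Module.finrank ℝ E < T.card) (c : E → ℝ) (hc : ∀ s ∈ T, 0 ≤ c s) :
    ∃ T' : Finset E, T' ⊂ T ∧ ∃ c' : E → ℝ, (∀ s ∈ T', 0 ≤ c' s) ∧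
      ∑ s ∈ T', c' s ≤ ∑ s ∈ T, c s ∧ ∑ s ∈ T', c' s • s = ∑ s ∈ T, c s • s := by
  obtain ⟨f0, hf0, x0, hx0, hfx0⟩ := Module.exists_nontrivial_relation_of_finrank_lt_card hT
  have : ∃ f : E → ℝ, ∑ s ∈ T, f s • s = 0 ∧ 0 ≤ ∑ s ∈ T, f s ∧ ∃ x ∈ T, 0 < f x := by
    have aux : ∀ f : E → ℝ, ∑ s ∈ T, f s • s = 0 → 0 ≤ ∑ s ∈ T, f s → f x0 ≠ 0 →
        ∃ x ∈ T, 0 < f x := by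
      intro f _ h2 h3
      by_contra hcon
      push Not at hcon
      have := Finset.sum_nonpos hcon
      have h4 := (Finset.sum_eq_zero_iff_of_nonpos hcon).1 (le_antisymm this h2) x0 hx0
      exact h3 h4
    rcases le_total 0 (∑ s ∈ T, f0 s) with h | h
    · exact ⟨f0, hf0, h, aux f0 hf0 h hfx0⟩
    · have h1 : ∑ s ∈ T, (-f0) s • s = 0 := by simp [hf0]
      have h2 : 0 ≤ ∑ s ∈ T, (-f0) s := by simpa using h
      exact ⟨-f0, h1, h2, aux _ h1 h2 (by simpa using hfx0)⟩
  obtain ⟨f, hf, hfs, x1, hx1, hfx1⟩ := this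
  obtain ⟨y, hy, hmin⟩ := Finset.exists_min_image (T.filter (fun s => 0 < f s))
    (fun s => c s / f s) ⟨x1, by simp [hx1, hfx1]⟩
  simp only [Finset.mem_filter] at hy hmin
  have hθ : 0 ≤ c y / f y := div_nonneg (hc y hy.1) hy.2.le
  let c' : E → ℝ := fun s => c s - c y / f y * f s
  have hcy : c' y = 0 := by
    simp only [c']; rw [div_mul_cancel₀ _ hy.2.ne']; ring
  have hcT : ∀ s ∈ T, 0 ≤ c' s := by
    intro s hs
    simp only [c']
    by_cases h : 0 < f s
    · have := hmin s ⟨hs, h⟩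
      rw [le_div_iff₀ h] at this
      linarith
    · push Not at h
      have := mul_nonpos_of_nonneg_of_nonpos hθ h
      linarith [hc s hs]
  refine ⟨T.erase y, Finset.erase_ssubset hy.1, c', fun s hs => hcT s (Finset.mem_of_mem_erase hs),
    ?_, ?_⟩
  · rw [Finset.sum_erase _ hcy]
    simp only [c', Finset.sum_sub_distrib, ← Finset.mul_sum]
    have := mul_nonneg hθ hfs
    linarith
  · rw [Finset.sum_erase _ (by rw [hcy, zero_smul])]
    simp only [c', sub_smul, Finset.sum_sub_distrib, mul_smul, ← Finset.smul_sum, hf]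
    simp

theorem carath_reduce {E : Type*} [AddCommGroup E] [Module ℝ E] [FiniteDimensional ℝ E]
    (n : ℕ) : ∀ (T : Finset E), T.card = n → ∀ (c : E → ℝ), (∀ s ∈ T, 0 ≤ c s) →
    ∃ T' : Finset E, T' ⊆ T ∧ T'.card ≤ Module.finrank ℝ E ∧ ∃ c' : E → ℝ, (∀ s ∈ T', 0 ≤ c' s) ∧
      ∑ s ∈ T', c' s ≤ ∑ s ∈ T, c s ∧ ∑ s ∈ T', c' s • s = ∑ s ∈ T, c s • s := by
  induction n using Nat.strong_induction_on with
  | _ n ih =>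
    intro T hTn c hc
    by_cases h : T.card ≤ Module.finrank ℝ E
    · exact ⟨T, subset_rfl, h, c, hc, le_rfl, rfl⟩
    · push Not at h
      obtain ⟨T1, hT1, c1, hc1, hs1, he1⟩ := carath_step T h c hc
      obtain ⟨T2, hT2, hcard, c2, hc2, hs2, he2⟩ :=
        ih T1.card (hTn ▸ Finset.card_lt_card hT1) T1 rfl c1 hc1
      exact ⟨T2, hT2.trans hT1.1, hcard, c2, hc2, hs2.trans hs1, he2.trans he1⟩

theorem convexHull_subset_conicK {E : Type*} [AddCommGroup E] [Module ℝ E]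
    [FiniteDimensional ℝ E] {S : Set E} (h0 : (0 : E) ∈ S) :
    convexHull ℝ S ⊆ conicK S (Module.finrank ℝ E) 1 := by
  intro x hx
  rw [convexHull_eq_union_convexHull_finite_subsets] at hx
  simp only [Set.mem_iUnion] at hx
  obtain ⟨T, hTS, hx⟩ := hx
  rw [Finset.convexHull_eq] at hx
  obtain ⟨w, hw0, hw1, rfl⟩ := hx
  rw [Finset.centerMass_eq_of_sum_1 _ _ hw1]
  obtain ⟨T', hT', hcard, c, hc, hs, he⟩ := carath_reduce T.card T rfl w hw0
  obtain ⟨k, hk⟩ := Nat.exists_eq_add_of_le hcard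
  rw [hk]
  apply conicK_add h0
  refine ⟨fun i => c (T'.equivFin.symm i), fun i => (T'.equivFin.symm i : E), ?_, ?_, ?_, ?_⟩
  · intro i; exact hc _ (T'.equivFin.symm i).2
  · rw [Equiv.sum_comp T'.equivFin.symm (fun i : T' => c i), Finset.sum_coe_sort T' c]
    linarith
  · intro i; exact hTS (hT' (T'.equivFin.symm i).2)
  · rw [Equiv.sum_comp T'.equivFin.symm (fun i : T' => c i • (i : E)),
      Finset.sum_coe_sort T' (fun i => c i • i), he]
    rfl

theorem conicK_subset_convexHull {E : Type*} [AddCommGroup E] [Module ℝ E]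
    {S : Set E} (h0 : (0 : E) ∈ S) (N : ℕ) : conicK S N 1 ⊆ convexHull ℝ S := by
  rintro x ⟨c, s, hc, hct, hs, rfl⟩
  have := (convex_convexHull ℝ S).sum_mem (t := Finset.univ)
    (w := fun o : Option (Fin N) => o.elim (1 - ∑ i, c i) c)
    (z := fun o : Option (Fin N) => o.elim 0 s) ?_ ?_ ?_
  · simpa [Fintype.sum_option] using this
  · rintro (_ | i) _
    · simpa using hct
    · exact hc i
  · simp [Fintype.sum_option]
  · rintro (_ | i) _
    · exact subset_convexHull _ _ h0
    · exact subset_convexHull _ _ (hs i)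

/-- The compact parameter set. -/
def paramK {E : Type*} (S : Set E) (N : ℕ) (t : ℝ) : Set ((Fin N → ℝ) × (Fin N → E)) :=
  {c | (∀ i, 0 ≤ c i) ∧ ∑ i, c i ≤ t} ×ˢ {s | ∀ i, s i ∈ S}

theorem isCompact_paramK {E : Type*} [NormedAddCommGroup E] {S : Set E}
    (hS : IsCompact S) (N : ℕ) (t : ℝ) : IsCompact (paramK S N t) := by
  refine IsCompact.prod ?_ ?_
  · refine (isCompact_univ_pi (fun _ : Fin N => isCompact_Icc (a := (0 : ℝ)) (b := t))).of_isClosed_subset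
      ?_ ?_
    · refine IsClosed.inter (s₁ := {c : Fin N → ℝ | ∀ i, 0 ≤ c i}) ?_ ?_
      · simp only [Set.ofPred_forall]
        exact isClosed_iInter fun i => isClosed_le continuous_const (continuous_apply i)
      · exact isClosed_le (f := fun c : Fin N → ℝ => ∑ i, c i) (g := fun _ => t) (by fun_prop) continuous_const
    · rintro c ⟨hc, hct⟩ i _
      exact ⟨hc i, (Finset.single_le_sum (fun j _ => hc j) (Finset.mem_univ i)).trans hct⟩
  · have := isCompact_univ_pi (fun _ : Fin N => hS)
    convert this using 1
    ext s; simp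

theorem isCompact_hull {E : Type*} [NormedAddCommGroup E] [NormedSpace ℝ E]
    [FiniteDimensional ℝ E] {S : Set E} (h0 : (0 : E) ∈ S) (hS : IsCompact S) :
    IsCompact (convexHull ℝ S) := by
  have h := (isCompact_paramK hS (Module.finrank ℝ E) 1).image
    (f := fun q => ∑ i, q.1 i • q.2 i) (by fun_prop)
  convert h using 1
  apply subset_antisymm
  · intro x hx
    obtain ⟨c, s, hc, hct, hs, rfl⟩ := convexHull_subset_conicK h0 hx
    exact ⟨(c, s), ⟨⟨hc, hct⟩, hs⟩, rfl⟩
  · rintro _ ⟨⟨c, s⟩, ⟨⟨hc, hct⟩, hs⟩, rfl⟩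
    exact conicK_subset_convexHull h0 _ ⟨c, s, hc, hct, hs, rfl⟩

/-! ### Signed measures as differences -/

theorem rep_self (μ : SignedMeasure Z) : μ = μ.toJordanDecomposition.posPart.toSignedMeasure -
    μ.toJordanDecomposition.negPart.toSignedMeasure :=
  (SignedMeasure.toSignedMeasure_toJordanDecomposition μ).symm

theorem rep_measure_eq (ρ σ : Measure Z) [IsFiniteMeasure ρ] [IsFiniteMeasure σ]
    (μ : SignedMeasure Z) (h : μ = ρ.toSignedMeasure - σ.toSignedMeasure) :
    ρ + μ.toJordanDecomposition.negPart = σ + μ.toJordanDecomposition.posPart := by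
  rw [← Measure.toSignedMeasure_eq_toSignedMeasure_iff, Measure.toSignedMeasure_add,
    Measure.toSignedMeasure_add]
  have h1 := rep_self μ
  rw [h] at h1
  rw [← h] at h1
  have h2 : ρ.toSignedMeasure - σ.toSignedMeasure = μ.toJordanDecomposition.posPart.toSignedMeasure -
    μ.toJordanDecomposition.negPart.toSignedMeasure := by rw [← h]; exact h1
  rw [sub_eq_sub_iff_add_eq_add] at h2
  rw [h2, add_comm]

theorem rep_le (ρ σ : Measure Z) [IsFiniteMeasure ρ] [IsFiniteMeasure σ]
    (μ : SignedMeasure Z) (h : μ = ρ.toSignedMeasure - σ.toSignedMeasure) :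
    μ.toJordanDecomposition.posPart ≤ ρ ∧ μ.toJordanDecomposition.negPart ≤ σ := by
  have he := rep_measure_eq ρ σ μ h
  obtain ⟨S, hS, hS1, hS2⟩ := μ.toJordanDecomposition.mutuallySingular
  have hap : ∀ B, ρ B + μ.toJordanDecomposition.negPart B =
      σ B + μ.toJordanDecomposition.posPart B := by
    intro B
    have := congrArg (fun m : Measure Z => m B) he
    simpa using this
  constructor
  · refine Measure.le_intro fun B hB _ => ?_
    have h1 : μ.toJordanDecomposition.posPart (B ∩ S) = 0 := measure_mono_null Set.inter_subset_right hS1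
    have h2 : μ.toJordanDecomposition.negPart (B \ S) = 0 := measure_mono_null (fun x hx => hx.2) hS2
    have h3 := hap (B \ S)
    rw [h2, add_zero] at h3
    rw [← measure_inter_add_sdiff B hS, h1, zero_add]
    calc _ ≤ σ (B \ S) + μ.toJordanDecomposition.posPart (B \ S) := le_add_self
      _ = ρ (B \ S) := h3.symm
      _ ≤ ρ B := measure_mono Set.sdiff_subset
  · refine Measure.le_intro fun B hB _ => ?_
    have h1 : μ.toJordanDecomposition.posPart (B ∩ S) = 0 := measure_mono_null Set.inter_subset_right hS1
    have h2 : μ.toJordanDecomposition.negPart (B \ S) = 0 := measure_mono_null (fun x hx => hx.2) hS2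
    have h3 := hap (B ∩ S)
    rw [h1, add_zero] at h3
    rw [← measure_inter_add_sdiff B hS, h2, add_zero]
    calc _ ≤ ρ (B ∩ S) + μ.toJordanDecomposition.negPart (B ∩ S) := le_add_self
      _ = σ (B ∩ S) := h3
      _ ≤ σ B := measure_mono Set.inter_subset_left

theorem rep_tv_le (ρ σ : Measure Z) [IsFiniteMeasure ρ] [IsFiniteMeasure σ]
    (μ : SignedMeasure Z) (h : μ = ρ.toSignedMeasure - σ.toSignedMeasure) :
    μ.totalVariation ≤ ρ + σ :=
  add_le_add (rep_le ρ σ μ h).1 (rep_le ρ σ μ h).2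

theorem rep_sInteg (ρ σ : Measure Z) [IsFiniteMeasure ρ] [IsFiniteMeasure σ]
    (μ : SignedMeasure Z) (h : μ = ρ.toSignedMeasure - σ.toSignedMeasure) (f : Z → ℝ)
    (hρ : Integrable f ρ) (hσ : Integrable f σ) :
    sInteg μ f = (∫ z, f z ∂ρ) - ∫ z, f z ∂σ := by
  have he := rep_measure_eq ρ σ μ h
  have hp := hρ.mono_measure (rep_le ρ σ μ h).1
  have hn := hσ.mono_measure (rep_le ρ σ μ h).2
  have := congrArg (fun m : Measure Z => ∫ z, f z ∂m) he
  rw [integral_add_measure hρ hn, integral_add_measure hσ hp] at this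
  unfold sInteg
  linarith

/-- A measure with finite first moment. -/
def FM (e : Z) (ρ : Measure Z) : Prop := Integrable (fun z => dist z e) ρ

theorem lip_integrable (e : Z) (ρ : Measure Z) [IsFiniteMeasure ρ] (hρ : FM e ρ) (f : Z → ℝ)
    (K : ℝ≥0) (hf : LipschitzWith K f) : Integrable f ρ := by
  have h1 : Integrable (fun z => |f e| + K * dist z e) ρ :=
    (integrable_const _).add (hρ.const_mul _)
  refine h1.mono' hf.continuous.measurable.aestronglyMeasurable (ae_of_all _ fun z => ?_)
  have := hf.dist_le_mul z e
  rw [Real.dist_eq] at this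
  have h2 : |f z| ≤ |f z - f e| + |f e| := by
    have := abs_add_le (f z - f e) (f e); simpa using this
  rw [Real.norm_eq_abs]; linarith

theorem integrable_dist_of_lint (e : Z) (ρ : Measure Z)
    (h : (∫⁻ z, ENNReal.ofReal (dist z e) ∂ρ) < ⊤) : FM e ρ := by
  refine ⟨(by fun_prop : Continuous fun z => dist z e).measurable.aestronglyMeasurable, ?_⟩
  rw [hasFiniteIntegral_iff_ofReal (ae_of_all _ fun z => dist_nonneg)]
  exact h

theorem lint_of_integrable_dist (e : Z) (ρ : Measure Z) (h : FM e ρ) :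
    (∫⁻ z, ENNReal.ofReal (dist z e) ∂ρ) < ⊤ := by
  have := h.2
  rwa [hasFiniteIntegral_iff_ofReal (ae_of_all _ fun z => dist_nonneg)] at this

theorem memM1_FM (e : Z) (μ : SignedMeasure Z) (h : MemM1 e μ) :
    FM e μ.toJordanDecomposition.posPart ∧ FM e μ.toJordanDecomposition.negPart := by
  have := integrable_dist_of_lint e _ h
  exact ⟨Integrable.mono_measure this (Measure.le_add_right le_rfl),
    Integrable.mono_measure this (Measure.le_add_left le_rfl)⟩

theorem rep_memM1 (e : Z) (ρ σ : Measure Z) [IsFiniteMeasure ρ] [IsFiniteMeasure σ]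
    (μ : SignedMeasure Z) (h : μ = ρ.toSignedMeasure - σ.toSignedMeasure)
    (hρ : FM e ρ) (hσ : FM e σ) : MemM1 e μ := by
  unfold MemM1
  refine lt_of_le_of_lt (lintegral_mono' (rep_tv_le ρ σ μ h) le_rfl) ?_
  exact lint_of_integrable_dist e _ (Integrable.add_measure hρ hσ)

theorem kru_le (e : Z) (μ : SignedMeasure Z) (k : ℝ) (hk : ∀ f : Z → ℝ, f e = 0 →
    LipschitzWith 1 f → sInteg μ f ≤ k) : kruNorm e μ ≤ |μ Set.univ| + k := by
  unfold kruNorm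
  gcongr
  refine csSup_le ⟨sInteg μ (fun _ => 0), _, rfl, LipschitzWith.const' 0 |>.weaken zero_le, rfl⟩ ?_
  rintro r ⟨f, h1, h2, rfl⟩
  exact hk f h1 h2

theorem lip_bound (e : Z) (ρ : Measure Z) [IsFiniteMeasure ρ] (hρ : FM e ρ) (f : Z → ℝ)
    (h0 : f e = 0) (hf : LipschitzWith 1 f) : |∫ z, f z ∂ρ| ≤ ∫ z, dist z e ∂ρ := by
  refine (abs_integral_le_integral_abs).trans (integral_mono (lip_integrable e ρ hρ f 1 hf).abs hρ ?_)
  intro z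
  have := hf.dist_le_mul z e
  simpa [h0] using this

theorem le_kru (e : Z) (μ : SignedMeasure Z) (hμ : MemM1 e μ) (f : Z → ℝ) (h0 : f e = 0)
    (hf : LipschitzWith 1 f) : |μ Set.univ| + sInteg μ f ≤ kruNorm e μ := by
  unfold kruNorm
  gcongr
  refine le_csSup ⟨(∫ z, dist z e ∂μ.toJordanDecomposition.posPart) +
    ∫ z, dist z e ∂μ.toJordanDecomposition.negPart, ?_⟩ ⟨f, h0, hf, rfl⟩
  rintro r ⟨f, h1, h2, rfl⟩
  have ha := lip_bound e _ (memM1_FM e μ hμ).1 f h1 h2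
  have hb := lip_bound e _ (memM1_FM e μ hμ).2 f h1 h2
  unfold sInteg
  rw [abs_le] at ha hb
  linarith

theorem kru_nonneg (e : Z) (μ : SignedMeasure Z) : 0 ≤ kruNorm e μ := by
  unfold kruNorm
  refine add_nonneg (abs_nonneg _) (Real.sSup_nonneg' ⟨0, ⟨fun _ => 0, rfl,
    LipschitzWith.const' 0 |>.weaken zero_le, ?_⟩, le_rfl⟩)
  simp [sInteg]

theorem memMp_M1 (e : Z) (p : ℝ) (hp : 1 < p) (μ : SignedMeasure Z) (h : MemMp e p μ) :
    MemM1 e μ := by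
  unfold MemM1
  have : IsFiniteMeasure μ.totalVariation := by unfold SignedMeasure.totalVariation; infer_instance
  calc (∫⁻ z, ENNReal.ofReal (dist z e) ∂μ.totalVariation)
      ≤ ∫⁻ z, 1 + ENNReal.ofReal (dist z e ^ p) ∂μ.totalVariation := by
        refine lintegral_mono fun z => ?_
        rw [← ENNReal.ofReal_one, ← ENNReal.ofReal_add zero_le_one (by positivity)]
        apply ENNReal.ofReal_le_ofReal
        rcases le_total (dist z e) 1 with h | h
        · have : 0 ≤ dist z e ^ p := by positivity
          linarith
        · have := Real.self_le_rpow_of_one_le h hp.le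
          linarith
    _ = μ.totalVariation Set.univ + ∫⁻ z, ENNReal.ofReal (dist z e ^ p) ∂μ.totalVariation := by
        rw [lintegral_add_left measurable_const]; simp
    _ < ⊤ := ENNReal.add_lt_top.2 ⟨measure_lt_top _ _, h⟩

theorem momLint_eq (e : Z) (p : ℝ) (ρ : Measure Z) :
    ∫⁻ z, ENNReal.ofReal (1 + dist z e ^ p) ∂ρ =
      ρ Set.univ + ∫⁻ z, ENNReal.ofReal (dist z e ^ p) ∂ρ := by
  have : ∀ z, ENNReal.ofReal (1 + dist z e ^ p) = 1 + ENNReal.ofReal (dist z e ^ p) := by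
    intro z
    rw [ENNReal.ofReal_add zero_le_one (by positivity), ENNReal.ofReal_one]
  simp_rw [this]
  rw [lintegral_add_left measurable_const]; simp

theorem memMp_iff (e : Z) (p : ℝ) (μ : SignedMeasure Z) : MemMp e p μ ↔ momLint e p μ < ⊤ := by
  have : IsFiniteMeasure μ.totalVariation := by unfold SignedMeasure.totalVariation; infer_instance
  unfold MemMp momLint
  rw [momLint_eq, ENNReal.add_lt_top]
  exact ⟨fun h => ⟨measure_lt_top _ _, h⟩, fun h => h.2⟩

/-- The real-valued regularizer. -/
def gR (e : Z) (p α β : ℝ) (μ : SignedMeasure Z) : ℝ :=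
  α * kruNorm e μ + β * (momLint e p μ).toReal

theorem rep_add (μ ν : SignedMeasure Z) : μ + ν =
    (μ.toJordanDecomposition.posPart + ν.toJordanDecomposition.posPart).toSignedMeasure -
    (μ.toJordanDecomposition.negPart + ν.toJordanDecomposition.negPart).toSignedMeasure := by
  rw [Measure.toSignedMeasure_add, Measure.toSignedMeasure_add]
  conv_lhs => rw [rep_self μ, rep_self ν]
  abel

theorem sInteg_add (e : Z) (μ ν : SignedMeasure Z) (hμ : MemM1 e μ) (hν : MemM1 e ν) (f : Z → ℝ)
    (K : ℝ≥0) (hf : LipschitzWith K f) : sInteg (μ + ν) f = sInteg μ f + sInteg ν f := by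
  have h1 := lip_integrable e _ (memM1_FM e μ hμ).1 f K hf
  have h2 := lip_integrable e _ (memM1_FM e μ hμ).2 f K hf
  have h3 := lip_integrable e _ (memM1_FM e ν hν).1 f K hf
  have h4 := lip_integrable e _ (memM1_FM e ν hν).2 f K hf
  rw [rep_sInteg _ _ _ (rep_add μ ν) f (h1.add_measure h3) (h2.add_measure h4),
    integral_add_measure h1 h3, integral_add_measure h2 h4]
  unfold sInteg
  ring

theorem mom_add (e : Z) (p : ℝ) (μ ν : SignedMeasure Z) :
    momLint e p (μ + ν) ≤ momLint e p μ + momLint e p ν := by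
  unfold momLint
  rw [← lintegral_add_measure]
  refine lintegral_mono' ((rep_tv_le _ _ _ (rep_add μ ν)).trans (le_of_eq ?_)) le_rfl
  unfold SignedMeasure.totalVariation
  abel

theorem good_add (e : Z) (p α β : ℝ) (hp : 1 < p) (hα : 0 < α) (hβ : 0 < β) (μ ν : SignedMeasure Z)
    (hμ : MemMp e p μ) (hν : MemMp e p ν) :
    MemMp e p (μ + ν) ∧ gR e p α β (μ + ν) ≤ gR e p α β μ + gR e p α β ν := by
  have hμ1 := memMp_M1 e p hp μ hμ
  have hν1 := memMp_M1 e p hp ν hν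
  rw [memMp_iff] at *
  refine ⟨(mom_add e p μ ν).trans_lt (ENNReal.add_lt_top.2 ⟨hμ, hν⟩), ?_⟩
  have hm : (momLint e p (μ + ν)).toReal ≤ (momLint e p μ).toReal + (momLint e p ν).toReal := by
    rw [← ENNReal.toReal_add hμ.ne hν.ne]
    exact ENNReal.toReal_mono (ENNReal.add_lt_top.2 ⟨hμ, hν⟩).ne (mom_add e p μ ν)
  have hk : kruNorm e (μ + ν) ≤ kruNorm e μ + kruNorm e ν := by
    have := kru_le e (μ + ν) (kruNorm e μ + kruNorm e ν - |μ Set.univ| - |ν Set.univ|) ?_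
    · have h2 : |(μ + ν) Set.univ| ≤ |μ Set.univ| + |ν Set.univ| := by
        simpa using abs_add_le (μ Set.univ) (ν Set.univ)
      linarith
    · intro f h0 hf
      rw [sInteg_add e μ ν hμ1 hν1 f 1 hf]
      have := le_kru e μ hμ1 f h0 hf
      have := le_kru e ν hν1 f h0 hf
      linarith
  unfold gR
  nlinarith [mul_le_mul_of_nonneg_left hm hβ.le, mul_le_mul_of_nonneg_left hk hα.le]

theorem rep_smul (c : ℝ≥0) (μ : SignedMeasure Z) : (c : ℝ) • μ =
    (c • μ.toJordanDecomposition.posPart).toSignedMeasure -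
    (c • μ.toJordanDecomposition.negPart).toSignedMeasure := by
  rw [Measure.toSignedMeasure_smul, Measure.toSignedMeasure_smul]
  conv_lhs => rw [rep_self μ]
  rw [smul_sub]; rfl

theorem good_smul (e : Z) (p α β : ℝ) (hp : 1 < p) (hα : 0 < α) (hβ : 0 < β) (μ : SignedMeasure Z)
    (hμ : MemMp e p μ) (c : ℝ) (hc : 0 ≤ c) :
    MemMp e p (c • μ) ∧ gR e p α β (c • μ) ≤ c * gR e p α β μ := by
  lift c to ℝ≥0 using hc
  have hμ1 := memMp_M1 e p hp μ hμ
  have hle : momLint e p ((c : ℝ) • μ) ≤ c * momLint e p μ := by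
    unfold momLint
    have : (c : ℝ≥0∞) * ∫⁻ z, ENNReal.ofReal (1 + dist z e ^ p) ∂μ.totalVariation =
       ∫⁻ z, ENNReal.ofReal (1 + dist z e ^ p) ∂(c • μ.totalVariation) := by
      rw [lintegral_smul_measure]; rfl
    rw [this]
    refine lintegral_mono' ((rep_tv_le _ _ _ (rep_smul c μ)).trans (le_of_eq ?_)) le_rfl
    unfold SignedMeasure.totalVariation
    rw [smul_add]
  rw [memMp_iff] at *
  have hlt : c * momLint e p μ < ⊤ := ENNReal.mul_lt_top ENNReal.coe_lt_top hμ
  refine ⟨hle.trans_lt hlt, ?_⟩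
  have hm : (momLint e p ((c : ℝ) • μ)).toReal ≤ c * (momLint e p μ).toReal := by
    have := ENNReal.toReal_mono hlt.ne hle
    simpa using this
  have hk : kruNorm e ((c : ℝ) • μ) ≤ c * kruNorm e μ := by
    have := kru_le e ((c : ℝ) • μ) (c * (kruNorm e μ - |μ Set.univ|)) ?_
    · have h2 : |((c : ℝ) • μ) Set.univ| = c * |μ Set.univ| := by
        simp [abs_mul]
      linarith
    · intro f h0 hf
      have h1 := lip_integrable e _ (memM1_FM e μ hμ1).1 f 1 hf
      have h2 := lip_integrable e _ (memM1_FM e μ hμ1).2 f 1 hf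
      rw [rep_sInteg _ _ _ (rep_smul c μ) f (h1.smul_measure_nnreal) (h2.smul_measure_nnreal),
        integral_smul_nnreal_measure, integral_smul_nnreal_measure]
      have := le_kru e μ hμ1 f h0 hf
      have h3 := mul_le_mul_of_nonneg_left (le_sub_iff_add_le'.2 this) c.2
      refine le_trans (le_of_eq ?_) h3
      unfold sInteg
      simp only [NNReal.smul_def, smul_eq_mul]
      change _ = (c : ℝ) * _
      ring
  unfold gR
  nlinarith [mul_le_mul_of_nonneg_left hm hβ.le, mul_le_mul_of_nonneg_left hk hα.le]

/-! ### Continuous functionals are integrals -/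

theorem simple_integral (ρ : Measure Z) [IsFiniteMeasure ρ] (s : SimpleFunc Z Z) (g : Z → ℝ) :
    ∫ z, g (s z) ∂ρ = ∑ v ∈ s.range, ρ.real (s ⁻¹' {v}) * g v := by
  have h : ∀ z, g (s z) = ∑ v ∈ s.range, (s ⁻¹' {v}).indicator (fun _ => g v) z := by
    intro z
    rw [Finset.sum_eq_single (s z)]
    · simp
    · intro b _ hb
      rw [Set.indicator_of_notMem]
      simpa using hb.symm
    · intro h; exact absurd (s.mem_range_self z) h
  simp_rw [h]
  rw [integral_finsetSum]
  · refine Finset.sum_congr rfl fun v _ => ?_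
    rw [integral_indicator_const _ (s.measurableSet_fiber v), smul_eq_mul]
  · intro v _
    exact (integrable_const _).indicator (s.measurableSet_fiber v)

theorem map_simple (ρ : Measure Z) [IsFiniteMeasure ρ] (s : SimpleFunc Z Z) :
    (ρ.map s).toSignedMeasure = ∑ v ∈ s.range, ρ.real (s ⁻¹' {v}) • diracSM v := by
  ext B hB
  rw [Measure.toSignedMeasure_apply_measurable hB, map_measureReal_apply s.measurable hB]
  have h1 := simple_integral ρ s (B.indicator 1)
  have h2 : ∫ z, B.indicator (1 : Z → ℝ) (s z) ∂ρ = ρ.real (s ⁻¹' B) := by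
    rw [← integral_indicator_one (s.measurable hB)]
    rfl
  rw [← h2, h1]
  have h3 : (∑ v ∈ s.range, ρ.real (s ⁻¹' {v}) • diracSM v) B =
      ∑ v ∈ s.range, (ρ.real (s ⁻¹' {v}) • diracSM v) B := by
    simp
  rw [h3]
  refine Finset.sum_congr rfl fun v _ => ?_
  have : diracSM v B = B.indicator 1 v := by
    rw [diracSM, Measure.toSignedMeasure_apply_measurable hB, measureReal_def,
      Measure.dirac_apply' _ hB]
    by_cases hv : v ∈ B <;> simp [hv]
  simp [this]

theorem FM_dirac (e x : Z) : FM e (Measure.dirac x) :=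
  integrable_dirac (by simp)

theorem dirac_univ (x : Z) : diracSM x Set.univ = 1 := by
  rw [diracSM, Measure.toSignedMeasure_apply_measurable MeasurableSet.univ]; simp

theorem rep_dirac (x : Z) : diracSM x =
    (Measure.dirac x).toSignedMeasure - (0 : Measure Z).toSignedMeasure := by
  simp [diracSM]

theorem rep_neg_dirac (x : Z) : -diracSM x =
    (0 : Measure Z).toSignedMeasure - (Measure.dirac x).toSignedMeasure := by
  simp [diracSM]

theorem FM_zero (e : Z) : FM e (0 : Measure Z) := integrable_zero_measure

theorem kru_dipole (e x y : Z) : kruNorm e (diracSM x - diracSM y) ≤ dist x y := by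
  have := kru_le e (diracSM x - diracSM y) (dist x y) ?_
  · simpa [dirac_univ] using this
  · intro f h0 hf
    rw [rep_sInteg (Measure.dirac x) (Measure.dirac y) (diracSM x - diracSM y) rfl f
      (lip_integrable e _ (FM_dirac e x) f 1 hf) (lip_integrable e _ (FM_dirac e y) f 1 hf),
      integral_dirac, integral_dirac]
    have := hf.dist_le_mul x y
    rw [Real.dist_eq] at this
    simpa using (le_abs_self _).trans this

theorem kru_dirac (e x : Z) : kruNorm e (diracSM x) ≤ 1 + dist x e := by
  have := kru_le e (diracSM x) (dist x e) ?_
  · simpa [dirac_univ] using this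
  · intro f h0 hf
    rw [rep_sInteg (Measure.dirac x) 0 _ (rep_dirac x) f
      (lip_integrable e _ (FM_dirac e x) f 1 hf) integrable_zero_measure,
      integral_dirac]
    have := hf.dist_le_mul x e
    rw [Real.dist_eq, h0] at this
    simpa using (le_abs_self _).trans this

theorem kru_neg_dirac (e x : Z) : kruNorm e (-diracSM x) ≤ 1 + dist x e := by
  have := kru_le e (-diracSM x) (dist x e) ?_
  · simpa [dirac_univ] using this
  · intro f h0 hf
    rw [rep_sInteg 0 (Measure.dirac x) _ (rep_neg_dirac x) f
      integrable_zero_measure (lip_integrable e _ (FM_dirac e x) f 1 hf),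
      integral_dirac]
    have := hf.dist_le_mul x e
    rw [Real.dist_eq, h0] at this
    simpa using (neg_le_abs _).trans this

theorem M1_dirac (e x : Z) : MemM1 e (diracSM x) :=
  rep_memM1 e _ _ _ (rep_dirac x) (FM_dirac e x) (FM_zero e)

theorem M1_dipole (e x y : Z) : MemM1 e (diracSM x - diracSM y) :=
  rep_memM1 e (Measure.dirac x) (Measure.dirac y) _ rfl (FM_dirac e x) (FM_dirac e y)

theorem rep_good (e : Z) (p α β : ℝ) (hα : 0 < α) (hβ : 0 < β) (μ : SignedMeasure Z)
    (ρ σ : Measure Z) [IsFiniteMeasure ρ] [IsFiniteMeasure σ]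
    (h : μ = ρ.toSignedMeasure - σ.toSignedMeasure) (k m : ℝ) (hm : 0 ≤ m)
    (hk : kruNorm e μ ≤ k)
    (hM : ∫⁻ z, ENNReal.ofReal (1 + dist z e ^ p) ∂ρ + ∫⁻ z, ENNReal.ofReal (1 + dist z e ^ p) ∂σ
      ≤ ENNReal.ofReal m) :
    MemMp e p μ ∧ gR e p α β μ ≤ α * k + β * m := by
  have h1 : momLint e p μ ≤ ENNReal.ofReal m := by
    refine le_trans ?_ hM
    rw [← lintegral_add_measure]
    exact lintegral_mono' (rep_tv_le ρ σ μ h) le_rfl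
  refine ⟨(memMp_iff e p μ).2 (h1.trans_lt ENNReal.ofReal_lt_top), ?_⟩
  have h2 : (momLint e p μ).toReal ≤ m := ENNReal.toReal_le_of_le_ofReal hm h1
  unfold gR
  gcongr

theorem good_dipole (e : Z) (p α β : ℝ) (hα : 0 < α) (hβ : 0 < β) (x y : Z) :
    MemMp e p (diracSM x - diracSM y) ∧ gR e p α β (diracSM x - diracSM y) ≤
      α * dist x y + β * ((1 + dist x e ^ p) + (1 + dist y e ^ p)) := by
  refine rep_good e p α β hα hβ _ (Measure.dirac x) (Measure.dirac y) rfl _ _ (by positivity)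
    (kru_dipole e x y) ?_
  rw [lintegral_dirac, lintegral_dirac, ← ENNReal.ofReal_add (by positivity) (by positivity)]

theorem good_dirac (e : Z) (p α β : ℝ) (hα : 0 < α) (hβ : 0 < β) (x : Z) :
    MemMp e p (diracSM x) ∧ gR e p α β (diracSM x) ≤
      α * (1 + dist x e) + β * (1 + dist x e ^ p) := by
  refine rep_good e p α β hα hβ _ (Measure.dirac x) 0 (rep_dirac x) _ _ (by positivity)
    (kru_dirac e x) ?_
  rw [lintegral_dirac]; simp

theorem good_neg_dirac (e : Z) (p α β : ℝ) (hα : 0 < α) (hβ : 0 < β) (x : Z) :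
    MemMp e p (-diracSM x) ∧ gR e p α β (-diracSM x) ≤
      α * (1 + dist x e) + β * (1 + dist x e ^ p) := by
  refine rep_good e p α β hα hβ _ 0 (Measure.dirac x) (rep_neg_dirac x) _ _ (by positivity)
    (kru_neg_dirac e x) ?_
  rw [lintegral_dirac]; simp

theorem functional_eq [TopologicalSpace.SeparableSpace Z] (e : Z) (l : SignedMeasure Z →ₗ[ℝ] ℝ)
    (C : ℝ) (hC : 0 ≤ C) (hl : ∀ μ, MemM1 e μ → |l μ| ≤ C * kruNorm e μ)
    (μ : SignedMeasure Z) (hμ : MemM1 e μ) :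
    l μ = sInteg μ (fun x => l (diracSM x)) := by
  set g : Z → ℝ := fun x => l (diracSM x) with hg
  have hgl : LipschitzWith ⟨C, hC⟩ g := by
    refine LipschitzWith.of_dist_le_mul fun x y => ?_
    rw [Real.dist_eq]
    simp only [hg]
    rw [← map_sub]
    exact (hl _ (M1_dipole e x y)).trans (mul_le_mul_of_nonneg_left (kru_dipole e x y) hC)
  set P := μ.toJordanDecomposition.posPart with hP
  set Q := μ.toJordanDecomposition.negPart with hQ
  obtain ⟨hPm, hQm⟩ := memM1_FM e μ hμ
  let s : ℕ → SimpleFunc Z Z := fun n =>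
    SimpleFunc.approxOn id measurable_id Set.univ e (Set.mem_univ e) n
  have hsd : ∀ n z, dist (s n z) z ≤ dist z e := by
    intro n z
    have := SimpleFunc.edist_approxOn_le (f := id) measurable_id (Set.mem_univ e) z n
    rw [edist_dist, edist_dist] at this
    rw [dist_comm z e]
    exact (ENNReal.ofReal_le_ofReal_iff dist_nonneg).1 this
  have hst : ∀ z, Tendsto (fun n => dist (s n z) z) atTop (𝓝 0) := by
    intro z
    rw [← tendsto_iff_dist_tendsto_zero]
    exact SimpleFunc.tendsto_approxOn (f := id) measurable_id (Set.mem_univ e) (by simp)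
  have hmeas : ∀ n, Measurable (fun z => dist (s n z) z) := fun n =>
    (s n).measurable.dist measurable_id
  -- error terms
  let ε : ℕ → ℝ := fun n => (∫ z, dist (s n z) z ∂P) + ∫ z, dist (s n z) z ∂Q
  have hεint : ∀ (ρ : Measure Z), FM e ρ → ∀ n, Integrable (fun z => dist (s n z) z) ρ := by
    intro ρ hR n
    refine Integrable.mono' hR (hmeas n).aestronglyMeasurable (ae_of_all _ fun z => ?_)
    rw [Real.norm_of_nonneg dist_nonneg]; exact hsd n z
  have hεR : ∀ (ρ : Measure Z), FM e ρ →
      Tendsto (fun n => ∫ z, dist (s n z) z ∂ρ) atTop (𝓝 0) := by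
    intro ρ hR
    have := tendsto_integral_of_dominated_convergence (μ := ρ) (fun z => dist z e)
      (F := fun n z => dist (s n z) z) (f := fun _ => (0 : ℝ))
      (fun n => (hmeas n).aestronglyMeasurable) hR
      (fun n => ae_of_all _ fun z => by rw [Real.norm_of_nonneg dist_nonneg]; exact hsd n z)
      (ae_of_all _ hst)
    simpa using this
  have hε : Tendsto ε atTop (𝓝 0) := by
    simpa using (hεR P hPm).add (hεR Q hQm)
  have hFMmap : ∀ (ρ : Measure Z) [IsFiniteMeasure ρ], FM e ρ → ∀ n, FM e (ρ.map (s n)) := by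
    intro ρ _ hR n
    unfold FM
    rw [integrable_map_measure (by fun_prop) (s n).measurable.aemeasurable]
    refine Integrable.mono' ((Integrable.add hR hR)) ?_ (ae_of_all _ fun z => ?_)
    · exact ((s n).measurable.dist measurable_const).aestronglyMeasurable
    · simp only [Function.comp, Pi.add_apply]
      rw [Real.norm_of_nonneg dist_nonneg]
      have := dist_triangle (s n z) z e
      linarith [hsd n z]
  -- Lipschitz estimate
  have hlip : ∀ (ρ : Measure Z) [IsFiniteMeasure ρ], FM e ρ → ∀ n (f : Z → ℝ) (K : ℝ≥0),
      LipschitzWith K f → |(∫ z, f z ∂ρ) - ∫ z, f (s n z) ∂ρ| ≤ K * ∫ z, dist (s n z) z ∂ρ := by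
    intro ρ _ hR n f K hf
    have hi1 := lip_integrable e ρ hR f K hf
    have hi2 : Integrable (fun z => f (s n z)) ρ := by
      have := lip_integrable e _ (hFMmap ρ hR n) f K hf
      rwa [integrable_map_measure hf.continuous.measurable.aestronglyMeasurable
        (s n).measurable.aemeasurable] at this
    rw [← integral_sub hi1 hi2, ← integral_const_mul]
    refine abs_integral_le_integral_abs.trans
      (integral_mono (hi1.sub hi2).abs ((hεint ρ hR n).const_mul _) fun z => ?_)
    have := hf.dist_le_mul (s n z) z
    rw [Real.dist_eq, abs_sub_comm] at this
    exact this
  let ν : ℕ → SignedMeasure Z := fun n =>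
    (P.map (s n)).toSignedMeasure - (Q.map (s n)).toSignedMeasure
  have hrep : ∀ n, μ - ν n =
      (P + Q.map (s n)).toSignedMeasure - (Q + P.map (s n)).toSignedMeasure := by
    intro n
    rw [Measure.toSignedMeasure_add, Measure.toSignedMeasure_add]
    conv_lhs => rw [rep_self μ]
    simp only [ν]
    abel
  have hM1 : ∀ n, MemM1 e (μ - ν n) := fun n =>
    rep_memM1 e _ _ _ (hrep n) (Integrable.add_measure hPm (hFMmap Q hQm n))
      (Integrable.add_measure hQm (hFMmap P hPm n))
  have hkru : ∀ n, kruNorm e (μ - ν n) ≤ ε n := by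
    intro n
    have h := kru_le e (μ - ν n) (ε n) ?_
    · have h0 : (μ - ν n) Set.univ = 0 := by
        rw [hrep n, Measure.toSignedMeasure_sub_apply MeasurableSet.univ,
          measureReal_add_apply, measureReal_add_apply,
          map_measureReal_apply (s n).measurable MeasurableSet.univ,
          map_measureReal_apply (s n).measurable MeasurableSet.univ]
        simp only [Set.preimage_univ]
        ring
      rw [h0] at h
      simpa using h
    · intro f h0 hf
      have i1 := lip_integrable e _ hPm f 1 hf
      have i2 := lip_integrable e _ hQm f 1 hf
      have i3 := lip_integrable e _ (hFMmap P hPm n) f 1 hf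
      have i4 := lip_integrable e _ (hFMmap Q hQm n) f 1 hf
      rw [rep_sInteg _ _ _ (hrep n) f (i1.add_measure i4) (i2.add_measure i3),
        integral_add_measure i1 i4, integral_add_measure i2 i3,
        integral_map (s n).measurable.aemeasurable hf.continuous.measurable.aestronglyMeasurable,
        integral_map (s n).measurable.aemeasurable hf.continuous.measurable.aestronglyMeasurable]
      have a1 := hlip P hPm n f 1 hf
      have a2 := hlip Q hQm n f 1 hf
      rw [abs_le] at a1 a2
      simp only [NNReal.coe_one, one_mul] at a1 a2
      simp only [ε]
      linarith
  have hlν : ∀ n, l (ν n) = (∫ z, g (s n z) ∂P) - ∫ z, g (s n z) ∂Q := by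
    intro n
    simp only [ν]
    rw [map_sub, map_simple, map_simple, simple_integral, simple_integral, map_sum, map_sum]
    simp [hg]
  have hbound : ∀ n, |l μ - sInteg μ g| ≤ 2 * C * ε n := by
    intro n
    have h1 := (hl _ (hM1 n)).trans (mul_le_mul_of_nonneg_left (hkru n) hC)
    rw [map_sub, hlν n] at h1
    have a1 := hlip P hPm n g _ hgl
    have a2 := hlip Q hQm n g _ hgl
    change |_| ≤ C * _ at a1 a2
    have hε' : C * ε n = C * (∫ z, dist (s n z) z ∂P) + C * ∫ z, dist (s n z) z ∂Q := by
      simp only [ε]; ring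
    have hs : sInteg μ g = (∫ z, g z ∂P) - ∫ z, g z ∂Q := rfl
    rw [hs]
    rw [abs_le] at *
    constructor <;> linarith
  have hlim : Tendsto (fun n => 2 * C * ε n) atTop (𝓝 0) := by
    simpa using hε.const_mul (2 * C)
  have := ge_of_tendsto' hlim hbound
  have := abs_eq_zero.1 (le_antisymm this (abs_nonneg _))
  exact sub_eq_zero.1 this

/-! ### Duality bound -/

theorem dual_bound (e : Z) (p α β : ℝ) (hp : 1 < p) (hα : 0 < α) (hβ : 0 < β)
    (g : Z → ℝ) (K : ℝ≥0) (hg : LipschitzWith K g)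
    (hd : ∀ x y, g x - g y ≤ α * dist x y + β * ((1 + dist x e ^ p) + (1 + dist y e ^ p)))
    (h1 : ∀ x, g x ≤ α * (1 + dist x e) + β * (1 + dist x e ^ p))
    (h2 : ∀ x, -g x ≤ α * (1 + dist x e) + β * (1 + dist x e ^ p))
    (μ : SignedMeasure Z) (hμ : MemMp e p μ) : sInteg μ g ≤ gR e p α β μ := by
  have hμ1 := memMp_M1 e p hp μ hμ
  let φ : Z → ℝ := fun z => 1 + dist z e ^ p
  let u : Z → Z → ℝ := fun x y => g y - β * φ y - α * dist x y
  have hub : ∀ x y, u x y ≤ g x + β * φ x := by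
    intro x y
    have := hd y x
    simp only [u, φ]
    rw [dist_comm x y]
    linarith
  have hbdd : ∀ x, BddAbove (Set.range (u x)) := fun x => ⟨_, by rintro _ ⟨y, rfl⟩; exact hub x y⟩
  have : Nonempty Z := ⟨e⟩
  let f : Z → ℝ := fun x => max (⨆ y, u x y) (-α - α * dist x e)
  have hfup : ∀ x, f x ≤ g x + β * φ x := by
    intro x
    refine max_le (ciSup_le (hub x)) ?_
    have := h2 x
    simp only [φ]; linarith
  have hflo : ∀ x, g x - β * φ x ≤ f x := by
    intro x
    refine le_trans ?_ (le_max_left _ _)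
    refine le_trans (le_of_eq ?_) (le_ciSup (hbdd x) x)
    simp [u]
  have hfe1 : f e ≤ α := by
    refine max_le (ciSup_le fun y => ?_) ?_
    · have := h1 y
      simp only [u, φ]; rw [dist_comm e y]; linarith
    · simp; linarith
  have hfe2 : -α ≤ f e := by
    refine le_trans ?_ (le_max_right _ _)
    simp
  have hfl : ∀ x y, f x ≤ f y + α * dist x y := by
    intro x y
    refine max_le (ciSup_le fun z => ?_) ?_
    · have a := le_ciSup (hbdd y) z
      have b : (⨆ y', u y y') ≤ f y := le_max_left _ _
      have c := mul_le_mul_of_nonneg_left (dist_triangle y x z) hα.le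
      rw [dist_comm y x] at c
      simp only [u] at a b ⊢
      linarith
    · have b : -α - α * dist y e ≤ f y := le_max_right _ _
      have c := mul_le_mul_of_nonneg_left (dist_triangle y x e) hα.le
      rw [dist_comm y x] at c
      linarith
  let f1 : Z → ℝ := fun x => (f x - f e) / α
  have hf1 : LipschitzWith 1 f1 := by
    refine LipschitzWith.of_le_add fun x y => ?_
    simp only [f1]
    rw [div_add' _ _ _ hα.ne']
    gcongr
    linarith [hfl x y]
  have hf10 : f1 e = 0 := by simp [f1]
  have hk := le_kru e μ hμ1 f1 hf10 hf1
  obtain ⟨hP, hQ⟩ := memM1_FM e μ hμ1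
  set P := μ.toJordanDecomposition.posPart with hPdef
  set Q := μ.toJordanDecomposition.negPart with hQdef
  have hφ : Integrable φ (P + Q) := by
    refine ⟨?_, ?_⟩
    · have : Measurable φ := by
        have : Measurable fun z => dist z e := (by fun_prop : Continuous fun z => dist z e).measurable
        exact measurable_const.add (this.pow_const p)
      exact this.aestronglyMeasurable
    · rw [hasFiniteIntegral_iff_ofReal (ae_of_all _ fun z => by simp only [φ, Pi.zero_apply]; positivity)]
      exact (memMp_iff e p μ).1 hμ
  have hφP : Integrable φ P := hφ.mono_measure (Measure.le_add_right le_rfl)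
  have hφQ : Integrable φ Q := hφ.mono_measure (Measure.le_add_left le_rfl)
  have hmom : (momLint e p μ).toReal = (∫ z, φ z ∂P) + ∫ z, φ z ∂Q := by
    rw [← integral_add_measure hφP hφQ]
    rw [integral_eq_lintegral_of_nonneg_ae
      (ae_of_all _ fun z => by simp only [φ, Pi.zero_apply]; positivity) hφ.1]
    rfl
  -- decompose
  have huniv : μ Set.univ = P.real Set.univ - Q.real Set.univ := by
    conv_lhs => rw [rep_self μ]
    exact Measure.toSignedMeasure_sub_apply MeasurableSet.univ
  have i1 := lip_integrable e P hP f1 1 hf1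
  have i2 := lip_integrable e Q hQ f1 1 hf1
  have hgP := lip_integrable e P hP g K hg
  have hgQ := lip_integrable e Q hQ g K hg
  have hff : ∀ x, f x = α * f1 x + f e := by
    intro x; simp only [f1]; field_simp; ring
  have j1 : Integrable (fun z => α * f1 z + f e) P := (i1.const_mul α).add (integrable_const _)
  have j2 : Integrable (fun z => α * f1 z + f e) Q := (i2.const_mul α).add (integrable_const _)
  have eP : ∫ z, (α * f1 z + f e + β * φ z) ∂P =
      α * (∫ z, f1 z ∂P) + P.real Set.univ * f e + β * ∫ z, φ z ∂P := by
    rw [integral_add j1 (hφP.const_mul β),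
      integral_add (i1.const_mul α) (integrable_const _), integral_const_mul, integral_const_mul,
      integral_const, smul_eq_mul]
  have eQ : ∫ z, (α * f1 z + f e - β * φ z) ∂Q =
      α * (∫ z, f1 z ∂Q) + Q.real Set.univ * f e - β * ∫ z, φ z ∂Q := by
    rw [integral_sub j2 (hφQ.const_mul β),
      integral_add (i2.const_mul α) (integrable_const _), integral_const_mul, integral_const_mul,
      integral_const, smul_eq_mul]
  have bP : ∫ z, g z ∂P ≤ ∫ z, (α * f1 z + f e + β * φ z) ∂P := by
    refine integral_mono hgP (j1.add (hφP.const_mul β))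
      fun z => ?_
    have := hflo z
    rw [hff] at this
    linarith
  have bQ : ∫ z, (α * f1 z + f e - β * φ z) ∂Q ≤ ∫ z, g z ∂Q := by
    refine integral_mono (j2.sub (hφQ.const_mul β)) hgQ
      fun z => ?_
    have := hfup z
    rw [hff] at this
    linarith
  have hs1 : sInteg μ f1 = (∫ z, f1 z ∂P) - ∫ z, f1 z ∂Q := rfl
  have hs2 : sInteg μ g = (∫ z, g z ∂P) - ∫ z, g z ∂Q := rfl
  have hab : f e * μ Set.univ ≤ α * |μ Set.univ| := by
    refine (le_abs_self _).trans ?_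
    rw [abs_mul]
    exact mul_le_mul_of_nonneg_right (abs_le.2 ⟨hfe2, hfe1⟩) (abs_nonneg _)
  rw [huniv] at hab hk
  have hk' := mul_le_mul_of_nonneg_left hk hα.le
  unfold gR
  rw [hmom, hs2]
  rw [hs1] at hk'
  rw [eP] at bP
  rw [eQ] at bQ
  nlinarith

/-! ### Compactness of the normalized atoms -/

theorem dipole_compact {E : Type*} [NormedAddCommGroup E] [NormedSpace ℝ E] [ProperSpace Z]
    (e : Z) (p α β : ℝ) (hp : 1 < p) (hα : 0 < α) (hβ : 0 < β) (h : Z → E) (C : ℝ) (hC : 0 ≤ C)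
    (hlip : ∀ x y, ‖h x - h y‖ ≤ C * dist x y) :
    IsCompact (insert 0 (Set.range fun q : Z × Z =>
      (α * dist q.1 q.2 + β * ((1 + dist q.1 e ^ p) + (1 + dist q.2 e ^ p)))⁻¹ • (h q.1 - h q.2))) := by
  have hc : Continuous h := by
    have : LipschitzWith ⟨C, hC⟩ h := LipschitzWith.of_dist_le_mul fun x y => by
      rw [dist_eq_norm]; exact hlip x y
    exact this.continuous
  have hpow : Continuous fun z : Z => dist z e ^ p :=
    (by fun_prop : Continuous fun z => dist z e).rpow_const fun _ => Or.inr (by linarith)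
  refine Tendsto.isCompact_insert_range_of_cocompact ?_ ?_
  · have hD : Tendsto (fun q : Z × Z => dist q (e, e)) (cocompact (Z × Z)) atTop :=
      tendsto_dist_right_cocompact_atTop (e, e)
    have hlim : Tendsto (fun q : Z × Z => (2 * C / β) * dist q (e, e) ^ (-(p - 1)))
        (cocompact (Z × Z)) (𝓝 0) := by
      have := ((tendsto_rpow_neg_atTop (show 0 < p - 1 by linarith)).comp hD).const_mul (2 * C / β)
      simpa using this
    refine squeeze_zero_norm' ?_ hlim
    filter_upwards [hD.eventually (eventually_ge_atTop 1)] with q hq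
    set D := dist q (e, e) with hDdef
    have hDm : D = max (dist q.1 e) (dist q.2 e) := rfl
    have hpos : 0 < β * D ^ p := by positivity
    have hDp : D ^ p ≤ dist q.1 e ^ p + dist q.2 e ^ p := by
      have a1 : 0 ≤ dist q.1 e ^ p := by positivity
      have a2 : 0 ≤ dist q.2 e ^ p := by positivity
      rcases max_choice (dist q.1 e) (dist q.2 e) with hh | hh <;> rw [hDm, hh] <;> linarith
    have hw : β * D ^ p ≤
        α * dist q.1 q.2 + β * ((1 + dist q.1 e ^ p) + (1 + dist q.2 e ^ p)) := by
      have : 0 ≤ α * dist q.1 q.2 := by positivity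
      nlinarith
    have hnum : ‖h q.1 - h q.2‖ ≤ C * (2 * D) := by
      refine (hlip _ _).trans (mul_le_mul_of_nonneg_left ?_ hC)
      have := dist_triangle_right q.1 q.2 e
      have b1 : dist q.1 e ≤ D := le_max_left _ _
      have b2 : dist q.2 e ≤ D := le_max_right _ _
      linarith
    rw [norm_smul, norm_inv, Real.norm_of_nonneg (hpos.le.trans hw)]
    calc _ ≤ (β * D ^ p)⁻¹ * (C * (2 * D)) := by gcongr
      _ = 2 * C / β * D ^ (-(p - 1)) := by
        have hD0 : 0 < D := by linarith
        rw [neg_sub, Real.rpow_sub hD0, Real.rpow_one]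
        field_simp
  · refine Continuous.smul (Continuous.inv₀ ?_ ?_) ?_
    · have c1 := hpow.comp (continuous_fst (X := Z) (Y := Z))
      have c2 := hpow.comp (continuous_snd (X := Z) (Y := Z))
      simp only [Function.comp_def] at c1 c2
      fun_prop
    · intro q
      have : 0 < β * ((1 + dist q.1 e ^ p) + (1 + dist q.2 e ^ p)) := by positivity
      have : 0 ≤ α * dist q.1 q.2 := by positivity
      linarith
    · fun_prop

theorem dirac_compact {E : Type*} [NormedAddCommGroup E] [NormedSpace ℝ E] [ProperSpace Z]
    (e : Z) (p α β : ℝ) (hp : 1 < p) (hα : 0 < α) (hβ : 0 < β) (h : Z → E) (C : ℝ) (hC : 0 ≤ C)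
    (hlip : ∀ x y, ‖h x - h y‖ ≤ C * dist x y) (hbd : ∀ x, ‖h x‖ ≤ C * (1 + dist x e)) :
    IsCompact (insert 0 (Set.range fun x : Z =>
      (α * (1 + dist x e) + β * (1 + dist x e ^ p))⁻¹ • h x)) := by
  have hc : Continuous h := by
    have : LipschitzWith ⟨C, hC⟩ h := LipschitzWith.of_dist_le_mul fun x y => by
      rw [dist_eq_norm]; exact hlip x y
    exact this.continuous
  have hpow : Continuous fun z : Z => dist z e ^ p :=
    (by fun_prop : Continuous fun z => dist z e).rpow_const fun _ => Or.inr (by linarith)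
  refine Tendsto.isCompact_insert_range_of_cocompact ?_ ?_
  · have hD : Tendsto (fun q : Z => dist q e) (cocompact Z) atTop :=
      tendsto_dist_right_cocompact_atTop e
    have hlim : Tendsto (fun q : Z => (2 * C / β) * dist q e ^ (-(p - 1)))
        (cocompact Z) (𝓝 0) := by
      have := ((tendsto_rpow_neg_atTop (show 0 < p - 1 by linarith)).comp hD).const_mul (2 * C / β)
      simpa using this
    refine squeeze_zero_norm' ?_ hlim
    filter_upwards [hD.eventually (eventually_ge_atTop 1)] with q hq
    set D := dist q e with hDdef
    have hpos : 0 < β * D ^ p := by positivity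
    have hw : β * D ^ p ≤ α * (1 + D) + β * (1 + D ^ p) := by
      have : 0 ≤ α * (1 + D) := by positivity
      nlinarith
    have hnum : ‖h q‖ ≤ C * (2 * D) :=
      (hbd _).trans (mul_le_mul_of_nonneg_left (by linarith) hC)
    rw [norm_smul, norm_inv, Real.norm_of_nonneg (hpos.le.trans hw)]
    calc _ ≤ (β * D ^ p)⁻¹ * (C * (2 * D)) := by gcongr
      _ = 2 * C / β * D ^ (-(p - 1)) := by
        have hD0 : 0 < D := by linarith
        rw [neg_sub, Real.rpow_sub hD0, Real.rpow_one]
        field_simp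
  · refine Continuous.smul (Continuous.inv₀ ?_ ?_) hc
    · fun_prop
    · intro q
      have : 0 < α * (1 + dist q e) + β * (1 + dist q e ^ p) := by positivity
      exact this.ne'


theorem good_zero (e : Z) (p α β : ℝ) (hp : 1 < p) (hα : 0 < α) (hβ : 0 < β) :
    MemMp e p (0 : SignedMeasure Z) ∧ gR e p α β (0 : SignedMeasure Z) ≤ 0 := by
  have := good_smul e p α β hp hα hβ (diracSM e) (good_dirac e p α β hα hβ e).1 0 le_rfl
  simpa using this

theorem gR_nonneg (e : Z) (p α β : ℝ) (hα : 0 < α) (hβ : 0 < β) (μ : SignedMeasure Z) :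
    0 ≤ gR e p α β μ :=
  add_nonneg (mul_nonneg hα.le (kru_nonneg e μ)) (mul_nonneg hβ.le ENNReal.toReal_nonneg)

theorem good_sum {ι : Type*} (e : Z) (p α β : ℝ) (hp : 1 < p) (hα : 0 < α) (hβ : 0 < β)
    (ν : ι → SignedMeasure Z) (hν : ∀ i, MemMp e p (ν i) ∧ gR e p α β (ν i) ≤ 1) (c : ι → ℝ)
    (hc : ∀ i, 0 ≤ c i) (s : Finset ι) :
    MemMp e p (∑ i ∈ s, c i • ν i) ∧ gR e p α β (∑ i ∈ s, c i • ν i) ≤ ∑ i ∈ s, c i := by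
  induction s using Finset.cons_induction with
  | empty => simpa using good_zero e p α β hp hα hβ
  | cons a s ha ih =>
    rw [Finset.sum_cons, Finset.sum_cons]
    have h1 := good_smul e p α β hp hα hβ (ν a) (hν a).1 (c a) (hc a)
    have h2 := good_add e p α β hp hα hβ _ _ h1.1 ih.1
    refine ⟨h2.1, h2.2.trans (add_le_add (h1.2.trans ?_) ih.2)⟩
    simpa using mul_le_mul_of_nonneg_left (hν a).2 (hc a)

theorem gR_eq_zero (e : Z) (p α β : ℝ) (hα : 0 < α) (hβ : 0 < β) (μ : SignedMeasure Z)
    (hμ : MemMp e p μ) (h : gR e p α β μ = 0) : μ = 0 := by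
  have h1 : (momLint e p μ).toReal = 0 := by
    unfold gR at h
    have a := mul_nonneg hα.le (kru_nonneg e μ)
    have b : 0 ≤ (momLint e p μ).toReal := ENNReal.toReal_nonneg
    have c : β * (momLint e p μ).toReal ≤ 0 := by linarith
    nlinarith
  rw [ENNReal.toReal_eq_zero_iff] at h1
  have h2 : momLint e p μ = 0 := h1.resolve_right ((memMp_iff e p μ).1 hμ).ne
  unfold momLint at h2
  rw [momLint_eq] at h2
  have h3 : μ.totalVariation Set.univ = 0 := (add_eq_zero.1 h2).1
  ext B hB
  rw [SignedMeasure.null_of_totalVariation_zero μ (measure_mono_null (Set.subset_univ B) h3)]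
  rfl

/-- Images of the normalized atoms. -/
def atomSet {E : Type*} [NormedAddCommGroup E] [NormedSpace ℝ E] (e : Z) (p α β : ℝ)
    (h : Z → E) : Set E :=
  insert 0 (Set.range fun q : Z × Z =>
      (α * dist q.1 q.2 + β * ((1 + dist q.1 e ^ p) + (1 + dist q.2 e ^ p)))⁻¹ • (h q.1 - h q.2)) ∪
  (insert 0 (Set.range fun x : Z => (α * (1 + dist x e) + β * (1 + dist x e ^ p))⁻¹ • h x) ∪
  insert 0 (Set.range fun x : Z => (α * (1 + dist x e) + β * (1 + dist x e ^ p))⁻¹ • -h x))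

theorem atom_lift {E : Type*} [NormedAddCommGroup E] [NormedSpace ℝ E] (e : Z) (p α β : ℝ)
    (hp : 1 < p) (hα : 0 < α) (hβ : 0 < β) (A : SignedMeasure Z →ₗ[ℝ] E) (s : E)
    (hs : s ∈ atomSet e p α β (fun x => A (diracSM x))) :
    ∃ ν : SignedMeasure Z, (MemMp e p ν ∧ gR e p α β ν ≤ 1) ∧ A ν = s ∧
      ∃ (c : ℝ) (z w : Z) (m : ℝ), ν = c • (diracSM z - diracSM w) + m • diracSM e := by
  have hzero : s = 0 → ∃ ν : SignedMeasure Z, (MemMp e p ν ∧ gR e p α β ν ≤ 1) ∧ A ν = s ∧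
      ∃ (c : ℝ) (z w : Z) (m : ℝ), ν = c • (diracSM z - diracSM w) + m • diracSM e := by
    rintro rfl
    have := good_zero e p α β hp hα hβ
    exact ⟨0, ⟨this.1, this.2.trans zero_le_one⟩, map_zero A, 0, e, e, 0, by simp⟩
  have hnorm : ∀ (a : SignedMeasure Z) (w : ℝ), 0 < w → MemMp e p a ∧ gR e p α β a ≤ w →
      MemMp e p (w⁻¹ • a) ∧ gR e p α β (w⁻¹ • a) ≤ 1 := by
    intro a w hw ha
    have h1 := good_smul e p α β hp hα hβ a ha.1 w⁻¹ (by positivity)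
    refine ⟨h1.1, h1.2.trans ?_⟩
    rw [inv_mul_le_iff₀ hw, mul_one]
    exact ha.2
  rcases hs with (hs | ⟨⟨x, y⟩, rfl⟩) | ((hs | ⟨x, rfl⟩) | (hs | ⟨x, rfl⟩))
  · exact hzero hs
  · refine ⟨_, hnorm _ _ ?_ (good_dipole e p α β hα hβ x y), ?_,
      (α * dist x y + β * ((1 + dist x e ^ p) + (1 + dist y e ^ p)))⁻¹, x, y, 0, ?_⟩
    · have : 0 < β * ((1 + dist x e ^ p) + (1 + dist y e ^ p)) := by positivity
      have : 0 ≤ α * dist x y := by positivity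
      linarith
    · simp
    · rw [zero_smul, add_zero]
  · exact hzero hs
  · refine ⟨_, hnorm _ _ (by positivity) (good_dirac e p α β hα hβ x), ?_,
      (α * (1 + dist x e) + β * (1 + dist x e ^ p))⁻¹, x, e,
      (α * (1 + dist x e) + β * (1 + dist x e ^ p))⁻¹, ?_⟩
    · simp
    · rw [← smul_add, sub_add_cancel]
  · exact hzero hs
  · refine ⟨_, hnorm _ _ (by positivity) (good_neg_dirac e p α β hα hβ x), ?_,
      (α * (1 + dist x e) + β * (1 + dist x e ^ p))⁻¹, e, x,
      -(α * (1 + dist x e) + β * (1 + dist x e ^ p))⁻¹, ?_⟩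
    · simp
    · generalize (α * (1 + dist x e) + β * (1 + dist x e ^ p))⁻¹ = r
      ext i hi
      simp only [VectorMeasure.add_apply, VectorMeasure.sub_apply, VectorMeasure.neg_apply,
        VectorMeasure.smul_apply, smul_eq_mul]
      ring

theorem mem_conic [TopologicalSpace.SeparableSpace Z] [ProperSpace Z]
    {E : Type*} [NormedAddCommGroup E] [NormedSpace ℝ E] [FiniteDimensional ℝ E] (e : Z)
    (p α β : ℝ) (hp : 1 < p) (hα : 0 < α) (hβ : 0 < β) (A : SignedMeasure Z →ₗ[ℝ] E)
    (C : ℝ) (hC : 0 ≤ C) (hA : ∀ μ, MemM1 e μ → ‖A μ‖ ≤ C * kruNorm e μ) :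
    IsCompact (atomSet e p α β (fun x => A (diracSM x))) ∧
    ∀ μ, MemMp e p μ →
      A μ ∈ conicK (atomSet e p α β (fun x => A (diracSM x))) (Module.finrank ℝ E)
        (gR e p α β μ) := by
  set h : Z → E := fun x => A (diracSM x) with hh
  have hlip : ∀ x y, ‖h x - h y‖ ≤ C * dist x y := by
    intro x y
    simp only [hh]
    rw [← map_sub]
    exact (hA _ (M1_dipole e x y)).trans (mul_le_mul_of_nonneg_left (kru_dipole e x y) hC)
  have hbd : ∀ x, ‖h x‖ ≤ C * (1 + dist x e) := fun x =>
    (hA _ (M1_dirac e x)).trans (mul_le_mul_of_nonneg_left (kru_dirac e x) hC)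
  have hcpt : IsCompact (atomSet e p α β h) := by
    refine (dipole_compact e p α β hp hα hβ h C hC hlip).union
      ((dirac_compact e p α β hp hα hβ h C hC hlip hbd).union
        (dirac_compact e p α β hp hα hβ (fun x => -h x) C hC ?_ ?_))
    · intro x y
      have := hlip x y
      rwa [← norm_neg, neg_sub, ← neg_sub_neg] at this
    · intro x; simpa using hbd x
  have h0 : (0 : E) ∈ atomSet e p α β h := Or.inl (Set.mem_insert _ _)
  refine ⟨hcpt, fun μ hμ => ?_⟩
  rcases (gR_nonneg e p α β hα hβ μ).eq_or_lt with ht | ht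
  · have := gR_eq_zero e p α β hα hβ μ hμ ht.symm
    rw [← ht, this, map_zero]
    exact ⟨fun _ => 0, fun _ => 0, fun _ => le_rfl, by simp, fun _ => h0, by simp⟩
  set t := gR e p α β μ with htdef
  have hmem : t⁻¹ • A μ ∈ convexHull ℝ (atomSet e p α β h) := by
    by_contra hcon
    obtain ⟨l, u, hl1, hl2⟩ := geometric_hahn_banach_closed_point
      (convex_convexHull ℝ (atomSet e p α β h)) (isCompact_hull h0 hcpt).isClosed hcon
    have hu : 0 < u := by simpa using hl1 0 (subset_convexHull _ _ h0)
    have hS : ∀ s ∈ atomSet e p α β h, u⁻¹ * l s ≤ 1 := by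
      intro s hs
      rw [inv_mul_le_iff₀ hu, mul_one]
      exact (hl1 s (subset_convexHull _ _ hs)).le
    let L : SignedMeasure Z →ₗ[ℝ] ℝ := (u⁻¹ • (l : E →ₗ[ℝ] ℝ)).comp A
    have hLapp : ∀ ν, L ν = u⁻¹ * l (A ν) := fun ν => rfl
    have hLb : ∀ ν, MemM1 e ν → |L ν| ≤ (u⁻¹ * (‖l‖ * C)) * kruNorm e ν := by
      intro ν hν
      rw [hLapp, abs_mul, abs_of_pos (inv_pos.2 hu), mul_assoc, mul_assoc]
      refine mul_le_mul_of_nonneg_left ?_ (inv_pos.2 hu).le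
      exact (l.le_opNorm _).trans (mul_le_mul_of_nonneg_left (hA ν hν) (norm_nonneg _))
    have hC' : 0 ≤ u⁻¹ * (‖l‖ * C) := by positivity
    have hfe := functional_eq e L _ hC' hLb μ (memMp_M1 e p hp μ hμ)
    have hgl : LipschitzWith ⟨_, hC'⟩ (fun x => L (diracSM x)) := by
      refine LipschitzWith.of_dist_le_mul fun x y => ?_
      rw [Real.dist_eq, ← map_sub]
      exact (hLb _ (M1_dipole e x y)).trans (mul_le_mul_of_nonneg_left (kru_dipole e x y) hC')
    have hw : ∀ (w : ℝ) (v : E), 0 < w → w⁻¹ • v ∈ atomSet e p α β h → u⁻¹ * l v ≤ w := by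
      intro w v hw hv
      have := hS _ hv
      rw [map_smul, smul_eq_mul, mul_left_comm, inv_mul_le_iff₀ hw, mul_one] at this
      exact this
    have hfinal := dual_bound e p α β hp hα hβ (fun x => L (diracSM x)) _ hgl ?_ ?_ ?_ μ hμ
    · rw [← hfe, hLapp, inv_mul_le_iff₀ hu] at hfinal
      rw [map_smul, smul_eq_mul, lt_inv_mul_iff₀ ht] at hl2
      linarith
    · intro x y
      rw [← map_sub, hLapp]
      refine hw _ _ ?_ (Or.inl (Or.inr ⟨(x, y), ?_⟩))
      · have : 0 < β * ((1 + dist x e ^ p) + (1 + dist y e ^ p)) := by positivity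
        have : 0 ≤ α * dist x y := by positivity
        linarith
      · simp [hh]
    · intro x
      exact hw _ _ (by positivity) (Or.inr (Or.inl (Or.inr ⟨x, rfl⟩)))
    · intro x
      have := hw _ (-h x) (by positivity) (Or.inr (Or.inr (Or.inr ⟨x, rfl⟩)))
      simpa [hLapp] using this
  obtain ⟨c, s, hc, hct, hs, heq⟩ := convexHull_subset_conicK h0 hmem
  refine ⟨fun i => t * c i, s, fun i => mul_nonneg ht.le (hc i), ?_, hs, ?_⟩
  · rw [← Finset.mul_sum]; nlinarith
  · simp_rw [mul_smul]
    rw [← Finset.smul_sum, ← heq, smul_inv_smul₀ ht.ne']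

theorem bdd_below_of_coercive {E : Type*} [NormedAddCommGroup E] [ProperSpace E] (F : E → EReal)
    (hFnebot : ∀ x, F x ≠ ⊥)
    (hFcoercive : ∀ c : ℝ, ∃ R : ℝ, ∀ x : E, R ≤ ‖x‖ → (c : EReal) ≤ F x)
    (hFlsc : LowerSemicontinuous F) : ∃ m : ℝ, ∀ x, (m : EReal) ≤ F x := by
  obtain ⟨R, hR⟩ := hFcoercive 0
  obtain ⟨x0, _, hmin⟩ := LowerSemicontinuousOn.exists_isMinOn
    (s := Metric.closedBall (0 : E) (max R 0)) ⟨0, by simp⟩ (isCompact_closedBall _ _)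
    (hFlsc.lowerSemicontinuousOn _)
  obtain ⟨m, _, hm⟩ := EReal.lt_iff_exists_real_btwn.1 (bot_lt_iff_ne_bot.2 (hFnebot x0))
  refine ⟨min m 0, fun x => ?_⟩
  by_cases hx : ‖x‖ ≤ max R 0
  · refine le_trans (le_trans ?_ hm.le) (hmin (by simpa using hx))
    exact_mod_cast min_le_left m 0
  · refine le_trans ?_ (hR x ((le_max_left _ _).trans (not_le.1 hx).le))
    exact_mod_cast min_le_right m 0

/-- (Representer theorem.) Suppose `H = ℝ^N`, `p > 1` and `α > 0`.  Then
the problem `inf_{μ ∈ KRu(Z)} F(Aμ) + G_{α,β}(μ)` has a minimizer `μ_min ∈ M_p(Z)` of the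
form `μ_min = ∑_{i=1}^N c_i (δ_{z_i} − δ_{w_i}) + μ_min(Z) δ_e`. -/
theorem representer_theorem_kru [LocallyCompactSpace Z] [CompleteSpace Z]
    [TopologicalSpace.SeparableSpace Z] (hgeo : IsGeodesic Z) (e : Z)
    (p α β : ℝ) (hp : 1 < p) (hα : 0 < α) (hβ : 0 < β) (N : ℕ)
    (A : SignedMeasure Z → EuclideanSpace ℝ (Fin N))
    (hAadd : ∀ μ ν : SignedMeasure Z, A (μ + ν) = A μ + A ν)
    (hAsmul : ∀ (c : ℝ) (μ : SignedMeasure Z), A (c • μ) = c • A μ)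
    (hAbdd : ∃ C : ℝ, ∀ μ : SignedMeasure Z, MemM1 e μ → ‖A μ‖ ≤ C * kruNorm e μ)
    (F : EuclideanSpace ℝ (Fin N) → EReal)
    (hFnebot : ∀ x, F x ≠ ⊥) (hFproper : ∃ x, F x ≠ ⊤)
    (hFconvex : ∀ x y : EuclideanSpace ℝ (Fin N), ∀ a b : ℝ, 0 ≤ a → 0 ≤ b → a + b = 1 →
      F (a • x + b • y) ≤ (a : EReal) * F x + (b : EReal) * F y)
    (hFcoercive : ∀ c : ℝ, ∃ R : ℝ, ∀ x : EuclideanSpace ℝ (Fin N),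
      R ≤ ‖x‖ → (c : EReal) ≤ F x)
    (hFlsc : LowerSemicontinuous F) :
    ∃ μmin : SignedMeasure Z, MemMp e p μmin ∧
      (∀ μ : SignedMeasure Z,
        F (A μmin) + Gab e p α β μmin ≤ F (A μ) + Gab e p α β μ) ∧
      ∃ (c : Fin N → ℝ) (z w : Fin N → Z),
        μmin = (∑ i, c i • (diracSM (z i) - diracSM (w i))) +
          μmin Set.univ • diracSM e := by
  have hproper : ProperSpace Z := hr_proper hgeo e
  obtain ⟨C0, hC0⟩ := hAbdd
  let AL : SignedMeasure Z →ₗ[ℝ] EuclideanSpace ℝ (Fin N) :=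
    { toFun := A, map_add' := hAadd, map_smul' := hAsmul }
  have hAL : ∀ μ, AL μ = A μ := fun _ => rfl
  have hA : ∀ μ, MemM1 e μ → ‖AL μ‖ ≤ |C0| * kruNorm e μ := fun μ hμ =>
    (hC0 μ hμ).trans (mul_le_mul_of_nonneg_right (le_abs_self _) (kru_nonneg e μ))
  obtain ⟨hcpt, hconic⟩ := mem_conic e p α β hp hα hβ AL |C0| (abs_nonneg _) hA
  set S := atomSet e p α β (fun x => AL (diracSM x)) with hSdef
  rw [finrank_euclideanSpace_fin] at hconic
  obtain ⟨m, hm⟩ := bdd_below_of_coercive F hFnebot hFcoercive hFlsc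
  have hGab : ∀ μ, MemMp e p μ → Gab e p α β μ = (gR e p α β μ : EReal) := by
    intro μ hμ
    unfold Gab gR
    rw [if_pos hμ]
  have hGtop : ∀ μ, ¬ MemMp e p μ → F (A μ) + Gab e p α β μ = ⊤ := by
    intro μ hμ
    unfold Gab
    rw [if_neg hμ]
    exact EReal.add_top_of_ne_bot (hFnebot _)
  by_cases hex : ∃ μ0, MemMp e p μ0 ∧ F (A μ0) ≠ ⊤
  · obtain ⟨μ0, hμ0, hF0⟩ := hex
    obtain ⟨v0, hv0⟩ : ∃ v0 : ℝ, F (A μ0) = v0 :=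
      ⟨(F (A μ0)).toReal, (EReal.coe_toReal hF0 (hFnebot _)).symm⟩
    have hmv : m ≤ v0 := by
      have := hm (A μ0)
      rw [hv0] at this
      exact_mod_cast this
    let J : (Fin N → ℝ) × (Fin N → EuclideanSpace ℝ (Fin N)) → EReal := fun q =>
      F (∑ i, q.1 i • q.2 i) + ((∑ i, q.1 i : ℝ) : EReal)
    have hJ : LowerSemicontinuous J := by
      refine LowerSemicontinuous.add' (hFlsc.comp (by fun_prop))
        (Continuous.lowerSemicontinuous (continuous_coe_real_ereal.comp (by fun_prop))) ?_
      intro q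
      exact EReal.continuousAt_add (Or.inr (EReal.coe_ne_bot _)) (Or.inr (EReal.coe_ne_top _))
    let T : ℝ := v0 + gR e p α β μ0 - m
    have hrep : ∀ μ, MemMp e p μ → gR e p α β μ ≤ T → ∃ q ∈ paramK S N T,
        J q ≤ F (A μ) + Gab e p α β μ := by
      intro μ hμ hT
      obtain ⟨c, s, hc, hct, hs, heq⟩ := hconic μ hμ
      refine ⟨(c, s), ⟨⟨hc, hct.trans hT⟩, hs⟩, ?_⟩
      rw [hGab μ hμ, ← hAL μ, heq]
      simp only [J]
      gcongr
    have hT0 : gR e p α β μ0 ≤ T := by simp only [T]; linarith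
    obtain ⟨q0, hq0, hJ0⟩ := hrep μ0 hμ0 hT0
    obtain ⟨⟨c, s⟩, ⟨⟨hc, hct⟩, hs⟩, hmin⟩ := LowerSemicontinuousOn.exists_isMinOn ⟨q0, hq0⟩
      (isCompact_paramK hcpt N T) (hJ.lowerSemicontinuousOn _)
    have hopt : ∀ μ, J (c, s) ≤ F (A μ) + Gab e p α β μ := by
      intro μ
      by_cases hμ : MemMp e p μ
      · by_cases hT : gR e p α β μ ≤ T
        · obtain ⟨q, hq, hJq⟩ := hrep μ hμ hT
          exact (hmin hq).trans hJq
        · refine ((hmin hq0).trans hJ0).trans ?_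
          rw [hGab μ hμ, hGab μ0 hμ0, hv0]
          refine le_trans ?_ (add_le_add_left (hm (A μ)) _)
          push Not at hT
          simp only [T] at hT
          norm_cast
          linarith
      · rw [hGtop μ hμ]; exact le_top
    choose ν hν1 hν2 a z w b hν3 using fun i => atom_lift e p α β hp hα hβ AL (s i) (hs i)
    have hsum := good_sum e p α β hp hα hβ ν hν1 c hc Finset.univ
    refine ⟨∑ i, c i • ν i, hsum.1, fun μ => le_trans ?_ (hopt μ), fun i => c i * a i, z, w, ?_⟩
    · rw [hGab _ hsum.1, ← hAL, map_sum]
      simp only [map_smul, hν2, J]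
      gcongr
      exact_mod_cast hsum.2
    · have hform : ∑ i, c i • ν i = (∑ i, (c i * a i) • (diracSM (z i) - diracSM (w i))) +
          (∑ i, c i * b i) • diracSM e := by
        rw [Finset.sum_smul, ← Finset.sum_add_distrib]
        refine Finset.sum_congr rfl fun i _ => ?_
        conv_lhs => rw [hν3 i]
        rw [smul_add, smul_smul, smul_smul]
      have huniv : (∑ i, c i • ν i) Set.univ = ∑ i, c i * b i := by
        rw [hform]
        simp [dirac_univ]
      rw [huniv]
      exact hform
  · push Not at hex
    refine ⟨0, (good_zero e p α β hp hα hβ).1, fun μ => ?_, fun _ => 0, fun _ => e, fun _ => e, ?_⟩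
    · by_cases hμ : MemMp e p μ
      · rw [hex μ hμ, hGab μ hμ, EReal.top_add_coe]; exact le_top
      · rw [hGtop μ hμ]; exact le_top
    · simp
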